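/- Let P ⊆ ℕ. If the topological entropy h_{σ_P} of the spacing shift (Σ_P, σ_P) is zero, then (Σ_P, σ_P) is proximal: every pair of points x, y ∈ Σ_P satisfies liminf_{n→∞} d(σⁿx, σⁿy) = 0. -/

import Mathlib

open Filter Topology

/-- The spacing shift `Σ_P ⊆ {0,1}^ℕ` determined by `P ⊆ ℕ`: a `0`-`1` sequence `x`
(encoded as `x : ℕ → Bool`) belongs to `Σ_P` iff whenever two coordinates are `1`,
the (positive) distance between them lies in `P`. -/
def SpacingShift (P : Set ℕ) : Set (ℕ → Bool) :=
  {x | ∀ i j : ℕ, i < j → x i = true → x j = true → j - i ∈ P}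

/-- The left shift map `σ` on sequences. -/
def shift (x : ℕ → Bool) : ℕ → Bool := fun n => x (n + 1)

/-- The support `A_y = {i : y_i = 1}` of a point of the shift space. -/
def supp (x : ℕ → Bool) : Set ℕ := {i | x i = true}

/-- `A ⊆ ℕ` has density `d`, i.e. `|A ∩ {1,…,n}| / n → d`. -/
def HasDensity (A : Set ℕ) (d : ℝ) : Prop :=
  Tendsto (fun n : ℕ => (Nat.card (A ∩ Set.Icc 1 n : Set ℕ) : ℝ) / n) atTop (𝓝 d)

/-- The upper density `d̄(A) = limsup_n |A ∩ {1,…,n}| / n`. -/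
noncomputable def upperDensity (A : Set ℕ) : ℝ :=
  limsup (fun n : ℕ => (Nat.card (A ∩ Set.Icc 1 n : Set ℕ) : ℝ) / n) atTop

/-- The upper Banach density `d*(A)`: the limsup, as the window length tends to infinity,
of the maximal proportion of elements of `A` in a window of that length. -/
noncomputable def upperBanachDensity (A : Set ℕ) : ℝ :=
  limsup (fun n : ℕ =>
    ⨆ m : ℕ, (Nat.card (A ∩ Set.Icc m (m + n) : Set ℕ) : ℝ) / (n + 1)) atTop

/-- `D ⊆ ℕ` is a Δ-set: it contains the difference set `{s_i - s_j : i > j}` of some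
strictly increasing sequence of natural numbers. -/
def IsDeltaSet (D : Set ℕ) : Prop :=
  ∃ s : ℕ → ℕ, StrictMono s ∧ ∀ i j : ℕ, j < i → s i - s j ∈ D

/-- `D ⊆ ℕ` is a Δ*-set: it meets every Δ-set. -/
def IsDeltaStarSet (D : Set ℕ) : Prop :=
  ∀ D' : Set ℕ, IsDeltaSet D' → (D ∩ D').Nonempty

open Classical in
/-- The standard metric on the shift space: `d(x,y) = 2^{-min{n : x_n ≠ y_n}}`,
and `d(x,x) = 0`. -/
noncomputable def seqDist (x y : ℕ → Bool) : ℝ :=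
  if x = y then 0 else (2 : ℝ)⁻¹ ^ sInf {n : ℕ | x n ≠ y n}

/-- The set `FS((a_n))` of finite sums of a sequence of natural numbers:
all sums `a_{i_1} + ⋯ + a_{i_k}` with `i_1 < ⋯ < i_k`. -/
def FSseq (a : ℕ → ℕ) : Set ℕ :=
  {n | ∃ F : Finset ℕ, F.Nonempty ∧ n = ∑ i ∈ F, a i}

/-- `S ⊆ ℕ` is an IP-set: it contains the finite sums of some sequence of positive
natural numbers. -/
def IsIPSet (S : Set ℕ) : Prop :=
  ∃ a : ℕ → ℕ, (∀ n, 0 < a n) ∧ FSseq a ⊆ S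

/-- The set `FS(A)` of finite sums of distinct elements of a set `A ⊆ ℕ`. -/
def FSset (A : Set ℕ) : Set ℕ :=
  {n | ∃ F : Finset ℕ, ↑F ⊆ A ∧ F.Nonempty ∧ n = ∑ i ∈ F, i}

/-- The spacing shift `(Σ_P, σ_P)` is topologically transitive: some point of `Σ_P`
has forward orbit (under the shift) dense in `Σ_P`. -/
def IsTransitiveShift (P : Set ℕ) : Prop :=
  ∃ x ∈ SpacingShift P, SpacingShift P ⊆ closure {y : ℕ → Bool | ∃ n : ℕ, shift^[n] x = y}

/-- `E ⊆ ℕ` is density intersective: it meets the difference set `A - A` of every set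
`A ⊆ ℕ` of positive upper Banach density. -/
def DensityIntersective (E : Set ℕ) : Prop :=
  ∀ A : Set ℕ, 0 < upperBanachDensity A → ∃ a ∈ A, ∃ a' ∈ A, a' < a ∧ a - a' ∈ E

lemma shift_iterate_apply (x : ℕ → Bool) (k n : ℕ) : shift^[k] x n = x (n + k) := by
  induction k generalizing x with
  | zero => rfl
  | succ k ih => rw [Function.iterate_succ_apply, ih]; simp [shift, add_assoc]

lemma seqDist_nonneg (x y : ℕ → Bool) : 0 ≤ seqDist x y := by
  unfold seqDist; split_ifs <;> positivity

lemma seqDist_le_one (x y : ℕ → Bool) : seqDist x y ≤ 1 := by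
  unfold seqDist
  split_ifs
  · exact zero_le_one
  · exact pow_le_one₀ (by norm_num) (by norm_num)

lemma exists_ne_of_pow_lt_seqDist {x y : ℕ → Bool} {N : ℕ}
    (h : (2 : ℝ)⁻¹ ^ N < seqDist x y) : ∃ i < N, x i ≠ y i := by
  unfold seqDist at h
  split_ifs at h with hxy
  · exact absurd h (not_lt.2 (by positivity))
  · refine ⟨_, ?_, Nat.sInf_mem (Function.ne_iff.1 hxy)⟩
    exact (pow_lt_pow_iff_right_of_lt_one₀ (by norm_num) (by norm_num)).1 h

/-- The entourage of pairs of sequences that agree at the coordinate `0`. -/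
def headEntourage : SetRel (ℕ → Bool) (ℕ → Bool) := {p | p.1 0 = p.2 0}

lemma headEntourage_mem_uniformity : headEntourage ∈ uniformity (ℕ → Bool) := by
  have h : {p : Bool × Bool | p.1 = p.2} ∈ uniformity Bool :=
    mem_principal.2 fun _ hp => hp
  exact (Pi.uniformContinuous_proj (fun _ : ℕ => Bool) 0) h

/-- Below every point of a spacing shift lie all points obtained by erasing ones, so each of its
words yields exponentially many words in the number of its ones. -/
lemma two_pow_count_le_netMaxcard {P : Set ℕ} {x : ℕ → Bool} (hx : x ∈ SpacingShift P) (n : ℕ) :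
    ((2 ^ Nat.count (fun i => x i = true) n : ℕ) : ℕ∞) ≤
      Dynamics.netMaxcard shift (SpacingShift P) headEntourage n := by
  classical
  set A : Finset ℕ := (Finset.range n).filter (fun i => x i = true)
  let f : Finset ℕ → ℕ → Bool := fun S i => decide (i ∈ S)
  have hf : Function.Injective f := fun S T hST => by
    ext i
    simpa [f] using congrFun hST i
  have hcard : (A.powerset.image f).card = 2 ^ Nat.count (fun i => x i = true) n := by
    rw [Finset.card_image_of_injective _ hf, Finset.card_powerset, Nat.count_eq_card_filter_range]
  rw [← hcard]
  apply Dynamics.IsDynNetIn.card_le_netMaxcard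
  constructor
  · intro z hz
    obtain ⟨S, hS, rfl⟩ := Finset.mem_image.1 (Finset.mem_coe.1 hz)
    rw [Finset.mem_powerset] at hS
    intro i j hij hi hj
    have hi' := hS (of_decide_eq_true hi)
    have hj' := hS (of_decide_eq_true hj)
    exact hx i j hij (Finset.mem_filter.1 hi').2 (Finset.mem_filter.1 hj').2
  · intro z hz w hw hzw
    obtain ⟨S, hS, rfl⟩ := Finset.mem_image.1 (Finset.mem_coe.1 hz)
    obtain ⟨T, hT, rfl⟩ := Finset.mem_image.1 (Finset.mem_coe.1 hw)
    rw [Finset.mem_powerset] at hS hT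
    refine Set.disjoint_left.2 fun u hu hu' => hzw ?_
    have agree : ∀ {v : ℕ → Bool}, u ∈ UniformSpace.ball v
        (Dynamics.dynEntourage shift headEntourage n) → ∀ k < n, v k = u k := by
      intro v hv k hk
      have := Dynamics.mem_dynEntourage.1 hv k hk
      simpa [headEntourage, shift_iterate_apply] using this
    funext k
    by_cases hk : k < n
    · rw [agree hu k hk, agree hu' k hk]
    · have outside : ∀ {R : Finset ℕ}, R ⊆ A → k ∉ R := fun hR hkR =>
        hk (Finset.mem_range.1 (Finset.mem_filter.1 (hR hkR)).1)
      simp [f, outside hS, outside hT]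

lemma count_ne_le_add (x y : ℕ → Bool) (n : ℕ) :
    Nat.count (fun i => x i ≠ y i) n ≤
      Nat.count (fun i => x i = true) n + Nat.count (fun i => y i = true) n := by
  induction n with
  | zero => simp
  | succ n ih =>
    simp only [Nat.count_succ]
    cases x n <;> cases y n <;> simp at ih ⊢ <;> omega

/-- A predicate that holds somewhere in every late window of length `N` has a linearly growing
counting function. -/
lemma le_count_of_syndetic {p : ℕ → Prop} [DecidablePred p] {n₀ N : ℕ}
    (h : ∀ n ≥ n₀, ∃ i < N, p (i + n)) (j : ℕ) : j ≤ Nat.count p (n₀ + N * j) := by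
  induction j with
  | zero => simp
  | succ j ih =>
    obtain ⟨i, hi, hp⟩ := h (n₀ + N * j) (by omega)
    have h1 := Nat.count_monotone p (show n₀ + N * j ≤ i + (n₀ + N * j) by omega)
    have h2 := Nat.count_strict_mono (n := n₀ + N * (j + 1)) hp (by rw [mul_add]; omega)
    omega

lemma not_syndetic_ne_of_coverEntropy_eq_zero {P : Set ℕ}
    (h : Dynamics.coverEntropy shift (SpacingShift P) = 0) {x y : ℕ → Bool}
    (hx : x ∈ SpacingShift P) (hy : y ∈ SpacingShift P) (n₀ N : ℕ) :
    ¬ ∀ n ≥ n₀, ∃ i < N, x (i + n) ≠ y (i + n) := by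
  intro H
  have hN : 0 < N := by
    obtain ⟨i, hi, -⟩ := H n₀ le_rfl
    omega
  let k : ℕ → ℕ := fun n =>
    max (Nat.count (fun i => x i = true) n) (Nat.count (fun i => y i = true) n)
  have hk : ∀ n ≥ 2 * (n₀ + N), n ≤ k n * (4 * N) := by
    intro n hn
    have h1 := le_count_of_syndetic (p := fun i => x i ≠ y i) H ((n - n₀) / N)
    have h2 := Nat.mul_div_le (n - n₀) N
    have h3 := Nat.count_monotone (fun i => x i ≠ y i)
      (show n₀ + N * ((n - n₀) / N) ≤ n by omega)
    have h4 := count_ne_le_add x y n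
    have h5 : (n - n₀) / N ≤ 2 * k n := by
      have := le_max_left (Nat.count (fun i => x i = true) n) (Nat.count (fun i => y i = true) n)
      have := le_max_right (Nat.count (fun i => x i = true) n) (Nat.count (fun i => y i = true) n)
      simp only [k]
      omega
    have h6 := Nat.lt_mul_div_succ (n - n₀) hN
    have h7 : N * ((n - n₀) / N + 1) ≤ N * (2 * k n + 1) := by gcongr
    have h8 : N * (2 * k n + 1) = 2 * (k n * N) + N := by ring
    have h9 : k n * (4 * N) = 4 * (k n * N) := by ring
    omega
  have hM : (0 : ℝ) < ((4 * N : ℕ) : ℝ) := by positivity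
  have hle : ∀ᶠ n in atTop, ((2 : ENNReal) ^ (((4 * N : ℕ) : ℝ)⁻¹)) ^ n ≤
      (Dynamics.netMaxcard shift (SpacingShift P) headEntourage n : ENNReal) := by
    filter_upwards [eventually_ge_atTop (2 * (n₀ + N))] with n hn
    have hnet : ((2 ^ k n : ℕ) : ℕ∞) ≤
        Dynamics.netMaxcard shift (SpacingShift P) headEntourage n := by
      rcases max_choice (Nat.count (fun i => x i = true) n)
        (Nat.count (fun i => y i = true) n) with hmax | hmax
      · simpa only [k, hmax] using two_pow_count_le_netMaxcard hx n
      · simpa only [k, hmax] using two_pow_count_le_netMaxcard hy n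
    have hpow : ((2 : ENNReal) ^ (((4 * N : ℕ) : ℝ)⁻¹)) ^ n ≤ (2 : ENNReal) ^ k n := by
      rw [← ENNReal.rpow_natCast, ← ENNReal.rpow_mul, ← ENNReal.rpow_natCast]
      refine ENNReal.rpow_le_rpow_of_exponent_le (by norm_num) ?_
      rw [inv_mul_le_iff₀ hM, mul_comm]
      exact_mod_cast hk n hn
    refine hpow.trans ?_
    have := ENat.toENNReal_mono hnet
    simpa using this
  have hgrowth := ExpGrowth.expGrowthSup_eventually_monotone hle
  rw [ExpGrowth.expGrowthSup_pow] at hgrowth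
  have hent := hgrowth.trans
    (Dynamics.netEntropyEntourage_le_coverEntropy (T := shift) (SpacingShift P)
      headEntourage_mem_uniformity)
  rw [h] at hent
  refine absurd hent (not_le.2 ?_)
  rw [← ENNReal.log_one]
  exact ENNReal.log_strictMono (ENNReal.one_lt_rpow (by norm_num) (by positivity))

/-- If `h_{σ_P} = 0` then `(Σ_P, σ_P)` is proximal. -/
theorem entropy_zero_implies_proximal (P : Set ℕ)
    (h : Dynamics.coverEntropy shift (SpacingShift P) = 0) :
    ∀ x ∈ SpacingShift P, ∀ y ∈ SpacingShift P,
      liminf (fun n : ℕ => seqDist (shift^[n] x) (shift^[n] y)) atTop = 0 := by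
  intro x hx y hy
  have hbdd : IsBoundedUnder (· ≥ ·) atTop
      (fun n : ℕ => seqDist (shift^[n] x) (shift^[n] y)) :=
    isBoundedUnder_of ⟨0, fun _ => seqDist_nonneg _ _⟩
  have hcobdd : IsCoboundedUnder (· ≥ ·) atTop
      (fun n : ℕ => seqDist (shift^[n] x) (shift^[n] y)) :=
    (isBoundedUnder_of ⟨1, fun _ => seqDist_le_one _ _⟩ :
      IsBoundedUnder (· ≤ ·) atTop _).isCoboundedUnder_ge
  refine le_antisymm (not_lt.1 fun hpos => ?_)
    (le_liminf_of_le hcobdd (Eventually.of_forall fun _ => seqDist_nonneg _ _))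
  obtain ⟨N, hN⟩ := exists_pow_lt_of_lt_one hpos (show (2 : ℝ)⁻¹ < 1 by norm_num)
  obtain ⟨n₀, hn₀⟩ := eventually_atTop.1 (eventually_lt_of_lt_liminf hN hbdd)
  refine not_syndetic_ne_of_coverEntropy_eq_zero h hx hy n₀ N fun n hn => ?_
  simpa only [shift_iterate_apply] using exists_ne_of_pow_lt_seqDist (hn₀ n hn)
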